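/- arXiv:1610.03404 — 11 statements merged into one kernel-verified Lean document; each statement's English description precedes it below -/
import Mathlib

section
/- Let θ > 0 and v, B ∈ ℝ³, and define m := (θ + |B|²)·v − (v·B)·B. Then v = (m + θ⁻¹·(m·B)·B) / (θ + |B|²). -/
open scoped RealInnerProductSpace

theorem stmt_1 (θ : ℝ) (hθ : 0 < θ) (v B m : EuclideanSpace ℝ (Fin 3))
    (hm : m = (θ + ‖B‖ ^ 2) • v - ⟪v, B⟫ • B) :
    v = (θ + ‖B‖ ^ 2)⁻¹ • (m + (θ⁻¹ * ⟪m, B⟫) • B) := by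
  have inner_m : ⟪m, B⟫ = θ * ⟪v, B⟫ := by
    rw [hm, inner_sub_left, real_inner_smul_left, real_inner_smul_left,
      real_inner_self_eq_norm_sq]
    ring
  have coeff_ne : θ + ‖B‖ ^ 2 ≠ 0 := by positivity
  rw [inner_m, inv_mul_cancel_left₀ hθ.ne', hm, sub_add_cancel, inv_smul_smul₀ coeff_ne]
end

section
/- Let θ > 0 and v, B ∈ ℝ³, and define m := (θ + |B|²)·v − (v·B)·B. Then |v|² = (θ²|m|² + 2θ(m·B)² + (m·B)²|B|²) / (θ²(θ + |B|²)²). Consequently, if moreover |v| < 1, the Lorentz factor γ := (1 − |v|²)^{−1/2} satisfies γ = (1 − (θ²|m|² + 2θ(m·B)² + (m·B)²|B|²)/(θ²(θ + |B|²)²))^{−1/2}. -/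
open scoped RealInnerProductSpace

theorem stmt_2 (θ : ℝ) (hθ : 0 < θ) (v B m : EuclideanSpace ℝ (Fin 3))
    (hm : m = (θ + ‖B‖ ^ 2) • v - ⟪v, B⟫ • B) :
    ‖v‖ ^ 2 =
      (θ ^ 2 * ‖m‖ ^ 2 + 2 * θ * ⟪m, B⟫ ^ 2 + ⟪m, B⟫ ^ 2 * ‖B‖ ^ 2) /
        (θ ^ 2 * (θ + ‖B‖ ^ 2) ^ 2) ∧
      (‖v‖ < 1 →
        (1 - ‖v‖ ^ 2) ^ (-(1 / 2 : ℝ)) =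
          (1 - (θ ^ 2 * ‖m‖ ^ 2 + 2 * θ * ⟪m, B⟫ ^ 2 + ⟪m, B⟫ ^ 2 * ‖B‖ ^ 2) /
              (θ ^ 2 * (θ + ‖B‖ ^ 2) ^ 2)) ^ (-(1 / 2 : ℝ))) := by
  have hmB : ⟪m, B⟫ = θ * ⟪v, B⟫ := by
    rw [hm, inner_sub_left, real_inner_smul_left, real_inner_smul_left,
      real_inner_self_eq_norm_sq]
    ring
  have hmm : ‖m‖ ^ 2 = (θ + ‖B‖ ^ 2) ^ 2 * ‖v‖ ^ 2
      - 2 * (θ + ‖B‖ ^ 2) * ⟪v, B⟫ ^ 2 + ⟪v, B⟫ ^ 2 * ‖B‖ ^ 2 := by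
    rw [hm, norm_sub_sq_real, real_inner_smul_left, real_inner_smul_right, norm_smul, norm_smul,
      mul_pow, mul_pow, Real.norm_eq_abs, Real.norm_eq_abs, sq_abs, sq_abs]
    ring
  have hv : ‖v‖ ^ 2 =
      (θ ^ 2 * ‖m‖ ^ 2 + 2 * θ * ⟪m, B⟫ ^ 2 + ⟪m, B⟫ ^ 2 * ‖B‖ ^ 2) /
        (θ ^ 2 * (θ + ‖B‖ ^ 2) ^ 2) := by
    have hpos : 0 < θ ^ 2 * (θ + ‖B‖ ^ 2) ^ 2 := by positivity
    rw [eq_div_iff hpos.ne', hmB, hmm]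
    ring
  exact ⟨hv, fun _ => by rw [← hv]⟩
end

section
/- Let ρ > 0, e ≥ 0, Γ > 1, and v, B ∈ ℝ³ with |v| < 1. Define γ := (1 − |v|²)^{−1/2}, p := (Γ − 1)ρe, h := 1 + e + p/ρ, θ := ρhγ², D := ργ, m := (θ + |B|²)v − (v·B)B, p_m := (1/2)(|B|²/γ² + (v·B)²), and E := ρhγ² − p − p_m + |B|². Then θ satisfies the scalar equation θ − ((Γ − 1)/Γ)(θ/γ² − D/γ) − (1/2)(|B|²/γ² + (m·B)²/θ²) + |B|² − E = 0. -/
open scoped RealInnerProductSpace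

theorem stmt_6 (ρ e Γ : ℝ) (hρ : 0 < ρ) (he : 0 ≤ e) (hΓ : 1 < Γ)
    (v B m : EuclideanSpace ℝ (Fin 3)) (hv : ‖v‖ < 1)
    (γ p h θ D pm E : ℝ)
    (hγ : γ = (1 - ‖v‖ ^ 2) ^ (-(1 / 2 : ℝ)))
    (hp : p = (Γ - 1) * ρ * e)
    (hh : h = 1 + e + p / ρ)
    (hθ : θ = ρ * h * γ ^ 2)
    (hD : D = ρ * γ)
    (hm : m = (θ + ‖B‖ ^ 2) • v - ⟪v, B⟫ • B)
    (hpm : pm = (1 / 2) * (‖B‖ ^ 2 / γ ^ 2 + ⟪v, B⟫ ^ 2))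
    (hE : E = ρ * h * γ ^ 2 - p - pm + ‖B‖ ^ 2) :
    θ - ((Γ - 1) / Γ) * (θ / γ ^ 2 - D / γ) -
        (1 / 2) * (‖B‖ ^ 2 / γ ^ 2 + ⟪m, B⟫ ^ 2 / θ ^ 2) + ‖B‖ ^ 2 - E = 0 := by
  have hγ_pos : 0 < γ := by
    rw [hγ]
    apply Real.rpow_pos_of_pos
    nlinarith [norm_nonneg v]
  have hρh : ρ * h = ρ + Γ * (ρ * e) := by
    rw [hh, hp]
    field_simp
    ring
  have hθ_pos : 0 < θ := by
    rw [hθ, hρh]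
    positivity
  have hmB : ⟪m, B⟫ = θ * ⟪v, B⟫ := by
    rw [hm, inner_sub_left, real_inner_smul_left, real_inner_smul_left,
      real_inner_self_eq_norm_sq]
    ring
  have h_momentum : ⟪m, B⟫ ^ 2 / θ ^ 2 = ⟪v, B⟫ ^ 2 := by
    rw [hmB]
    field_simp
  have h_pressure : (Γ - 1) / Γ * (θ / γ ^ 2 - D / γ) = p := by
    rw [hθ, hD, hρh, hp]
    field_simp
    ring
  rw [h_momentum, h_pressure, hE, hpm, ← hθ]
  ring
end

section
/- Let ρ > 0, e ≥ 0, Γ > 1, and v, B ∈ ℝ³ with |v| < 1. Define γ := (1 − |v|²)^{−1/2}, p := (Γ − 1)ρe, h := 1 + e + p/ρ, θ := ρhγ², p_m := (1/2)(|B|²/γ² + (v·B)²), and E := ρhγ² − p − p_m + |B|². Then θ < Γ·E. -/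
open scoped RealInnerProductSpace

/-- The squared Lorentz factor is `1 / (1 - |v|²)`. -/
theorem lorentz_factor_sq {x : ℝ} (hx : 0 < x) : (x ^ (-(1 / 2 : ℝ))) ^ 2 = x⁻¹ := by
  rw [← Real.rpow_natCast, ← Real.rpow_mul hx.le, ← Real.rpow_neg_one]
  norm_num

/-- The magnetic pressure is at most half of `|B|²`. -/
theorem magnetic_pressure_le {V : Type*} [NormedAddCommGroup V] [InnerProductSpace ℝ V]
    (v B : V) : (1 / 2) * (‖B‖ ^ 2 * (1 - ‖v‖ ^ 2) + ⟪v, B⟫ ^ 2) ≤ (1 / 2) * ‖B‖ ^ 2 := by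
  have h := sq_le_sq.mpr ((abs_real_inner_le_norm v B).trans (le_abs_self _))
  nlinarith

theorem stmt_7 (ρ e Γ : ℝ) (hρ : 0 < ρ) (he : 0 ≤ e) (hΓ : 1 < Γ)
    (v B : EuclideanSpace ℝ (Fin 3)) (hv : ‖v‖ < 1)
    (γ p h θ pm E : ℝ)
    (hγ : γ = (1 - ‖v‖ ^ 2) ^ (-(1 / 2 : ℝ)))
    (hp : p = (Γ - 1) * ρ * e)
    (hh : h = 1 + e + p / ρ)
    (hθ : θ = ρ * h * γ ^ 2)
    (hpm : pm = (1 / 2) * (‖B‖ ^ 2 / γ ^ 2 + ⟪v, B⟫ ^ 2))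
    (hE : E = ρ * h * γ ^ 2 - p - pm + ‖B‖ ^ 2) :
    θ < Γ * E := by
  have hx : 0 < 1 - ‖v‖ ^ 2 := by nlinarith [norm_nonneg v]
  have hγ2 : γ ^ 2 = (1 - ‖v‖ ^ 2)⁻¹ := by rw [hγ, lorentz_factor_sq hx]
  have hγ1 : 1 ≤ γ ^ 2 := by
    rw [hγ2]
    exact (one_le_inv₀ hx).mpr (by linarith [sq_nonneg ‖v‖])
  have hpm_le : pm ≤ (1 / 2) * ‖B‖ ^ 2 := by
    rw [hpm, hγ2, div_inv_eq_mul]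
    exact magnetic_pressure_le v B
  have hρh : ρ * h = ρ + Γ * (ρ * e) := by
    rw [hh, hp]
    field_simp
    ring
  have hρe : 0 ≤ ρ * e := by positivity
  have hθ_ge : ρ + Γ * (ρ * e) ≤ θ := by
    rw [hθ, hρh]
    exact le_mul_of_one_le_right (by positivity) hγ1
  have hE_ge : θ - p ≤ E := by linarith [sq_nonneg ‖B‖]
  calc θ < θ + (Γ - 1) * (θ - Γ * (ρ * e)) :=
        lt_add_of_pos_right _ (mul_pos (by linarith) (by linarith))
    _ = Γ * (θ - p) := by rw [hp]; ring
    _ ≤ Γ * E := by gcongr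
end

section
/- Let v ∈ ℝ³ with |v| < 1, γ := (1 − |v|²)^{−1/2}, and B ∈ ℝ³ with B₁ = 0; set b⁰ := γ(v·B), b¹ := γ(B₁/γ² + v₁(v·B)) = γv₁(v·B), and |b|² := |B|²/γ² + (v·B)². Let ρ, h, c_s ∈ ℝ and for λ ∈ ℝ set a := γ(λ − v₁). Then ρh(1 − c_s²)a⁴ − (1 − λ²)[(|b|² + ρh c_s²)a² − c_s²(b¹ − λb⁰)²] = a²·(a₂λ² + a₁λ + a₀), where a₂ = ρh[c_s² + γ²(1 − c_s²)] + |b|² − c_s²(v·B)², a₁ = −2ρhγ²v₁(1 − c_s²), and a₀ = ρh[−c_s² + γ²v₁²(1 − c_s²)] − |b|² + c_s²(v·B)². Consequently, every root λ ≠ v₁ of the magnetosonic quartic equation satisfies the quadratic equation a₂λ² + a₁λ + a₀ = 0. -/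
open scoped RealInnerProductSpace

theorem stmt_9 (v B : EuclideanSpace ℝ (Fin 3)) (hv : ‖v‖ < 1) (hB₁ : B 0 = 0)
    (γ : ℝ) (hγ : γ = (1 - ‖v‖ ^ 2) ^ (-(1 / 2 : ℝ)))
    (b0 b1 bsq : ℝ)
    (hb0 : b0 = γ * ⟪v, B⟫)
    (hb1 : b1 = γ * (B 0 / γ ^ 2 + v 0 * ⟪v, B⟫))
    (hbsq : bsq = ‖B‖ ^ 2 / γ ^ 2 + ⟪v, B⟫ ^ 2)
    (ρ h cs a₂ a₁ a₀ : ℝ)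
    (ha₂ : a₂ = ρ * h * (cs ^ 2 + γ ^ 2 * (1 - cs ^ 2)) + bsq - cs ^ 2 * ⟪v, B⟫ ^ 2)
    (ha₁ : a₁ = -2 * ρ * h * γ ^ 2 * v 0 * (1 - cs ^ 2))
    (ha₀ : a₀ = ρ * h * (-cs ^ 2 + γ ^ 2 * (v 0) ^ 2 * (1 - cs ^ 2)) - bsq +
      cs ^ 2 * ⟪v, B⟫ ^ 2) :
    (∀ lam : ℝ,
        ρ * h * (1 - cs ^ 2) * (γ * (lam - v 0)) ^ 4 -
            (1 - lam ^ 2) * ((bsq + ρ * h * cs ^ 2) * (γ * (lam - v 0)) ^ 2 -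
              cs ^ 2 * (b1 - lam * b0) ^ 2) =
          (γ * (lam - v 0)) ^ 2 * (a₂ * lam ^ 2 + a₁ * lam + a₀)) ∧
      ∀ lam : ℝ, lam ≠ v 0 →
        (ρ * h * (1 - cs ^ 2) * (γ * (lam - v 0)) ^ 4 =
            (1 - lam ^ 2) * ((bsq + ρ * h * cs ^ 2) * (γ * (lam - v 0)) ^ 2 -
              cs ^ 2 * (b1 - lam * b0) ^ 2)) →
          a₂ * lam ^ 2 + a₁ * lam + a₀ = 0 := by
  have hγ0 : γ ≠ 0 := by
    have hpos : 0 < 1 - ‖v‖ ^ 2 := by nlinarith [norm_nonneg v]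
    rw [hγ]
    exact (Real.rpow_pos_of_pos hpos _).ne'
  have factorization : ∀ lam : ℝ,
      ρ * h * (1 - cs ^ 2) * (γ * (lam - v 0)) ^ 4 -
          (1 - lam ^ 2) * ((bsq + ρ * h * cs ^ 2) * (γ * (lam - v 0)) ^ 2 -
            cs ^ 2 * (b1 - lam * b0) ^ 2) =
        (γ * (lam - v 0)) ^ 2 * (a₂ * lam ^ 2 + a₁ * lam + a₀) := by
    intro lam
    rw [hb1, hb0, ha₂, ha₁, ha₀, hB₁, zero_div]
    ring
  refine ⟨factorization, fun lam hlam hroot => ?_⟩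
  have hprod := (factorization lam).symm.trans (sub_eq_zero.mpr hroot)
  exact (mul_eq_zero.mp hprod).resolve_left
    (pow_ne_zero 2 (mul_ne_zero hγ0 (sub_ne_zero.mpr hlam)))
end

section
/- Fix hx, hy > 0 and work in the real polynomial ring ℝ[ξ, η]. Define the fourteen vector-valued polynomials φ⁰ = (0, 1), φ¹ = (1, 0), φ² = (0, ξ), φ³ = (η, 0), φ⁴ = (hx·ξ, −hy·η), φ⁵ = (η² − 1/3, 0), φ⁶ = (0, ξ² − 1/3), φ⁷ = (hx(ξ² − 1/3), −2hy·ξη), φ⁸ = (−2hx·ξη, hy(η² − 1/3)), φ⁹ = (η³ − (3/5)η, 0), φ¹⁰ = (0, ξ³ − (3/5)ξ), φ¹¹ = (hx(ξ² − 1/3)η, −hy·ξ(η² − 1/3)), φ¹² = (hx·ξ(η² − 1/3), −hy(η³ − η)/3), φ¹³ = (hx(ξ³ − ξ)/3, −hy(ξ² − 1/3)η). Then these fourteen vectors are linearly independent over ℝ, each has both components of total degree at most 3 and satisfies (2/hx)·∂φ₁/∂ξ + (2/hy)·∂φ₂/∂η = 0, and their linear span equals the space W³ := {(v₁, v₂)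 : v₁, v₂ ∈ ℝ[ξ, η] of total degree ≤ 3 and (2/hx)·∂v₁/∂ξ + (2/hy)·∂v₂/∂η = 0}; in particular dim W³ = 14. -/
open MvPolynomial

/-- The polynomial `∑ A i j X₀ ^ i X₁ ^ j` of degree at most three in each variable. -/
noncomputable def bicubic (A : Matrix (Fin 4) (Fin 4) ℝ) : MvPolynomial (Fin 2) ℝ :=
  ∑ i : Fin 4, ∑ j : Fin 4, C (A i j) * (X 0 ^ (i : ℕ) * X 1 ^ (j : ℕ))

theorem C_mul_X_pow_mul_X_pow_eq_monomial (a : ℝ) (i j : ℕ) :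
    (C a * (X 0 ^ i * X 1 ^ j) : MvPolynomial (Fin 2) ℝ) =
      monomial (Finsupp.single 0 i + Finsupp.single 1 j) a := by
  rw [X_pow_eq_monomial, X_pow_eq_monomial, monomial_mul, C_mul_monomial]
  simp

theorem coeff_bicubic (A : Matrix (Fin 4) (Fin 4) ℝ) (m : Fin 2 →₀ ℕ) :
    coeff m (bicubic A) = ∑ i : Fin 4, ∑ j : Fin 4, if m 0 = i ∧ m 1 = j then A i j else 0 := by
  simp only [bicubic, C_mul_X_pow_mul_X_pow_eq_monomial, coeff_sum, coeff_monomial]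
  refine Finset.sum_congr rfl fun i _ => Finset.sum_congr rfl fun j _ => if_congr ?_ rfl rfl
  simp [Finsupp.ext_iff, Fin.forall_fin_two, eq_comm]

theorem bicubic_eq_zero_iff {A : Matrix (Fin 4) (Fin 4) ℝ} : bicubic A = 0 ↔ A = 0 := by
  refine ⟨fun h => ?_, fun h => by simp [h, bicubic]⟩
  ext i j
  have := congrArg (coeff (Finsupp.single 0 (i : ℕ) + Finsupp.single 1 (j : ℕ))) h
  simpa [coeff_bicubic, Fin.val_inj, ite_and] using this

theorem exists_bicubic_eq_of_totalDegree_le {p : MvPolynomial (Fin 2) ℝ}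
    (hp : p.totalDegree ≤ 3) :
    ∃ A : Matrix (Fin 4) (Fin 4) ℝ, (∀ i j : Fin 4, 3 < (i : ℕ) + j → A i j = 0) ∧
      bicubic A = p := by
  refine ⟨.of fun i j => coeff (Finsupp.single 0 (i : ℕ) + Finsupp.single 1 (j : ℕ)) p,
    fun i j h => coeff_eq_zero_of_totalDegree_lt (hp.trans_lt ?_), ?_⟩
  · change 3 < Finsupp.degree _
    simpa using h
  symm
  ext m
  have hm : m = Finsupp.single 0 (m 0) + Finsupp.single 1 (m 1) := by
    simp [Finsupp.ext_iff, Fin.forall_fin_two]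
  rw [coeff_bicubic]
  by_cases h : m 0 < 4 ∧ m 1 < 4
  · rw [Finset.sum_eq_single ⟨m 0, h.1⟩, Finset.sum_eq_single ⟨m 1, h.2⟩]
    · simp [← hm]
    · intro j _ hj
      simp [Fin.ext_iff] at hj ⊢
      omega
    · simp
    · intro i _ hi
      refine Finset.sum_eq_zero fun j _ => if_neg fun h' => hi (Fin.ext h'.1.symm)
    · simp
  · refine .trans ?_ (Finset.sum_eq_zero fun i _ => Finset.sum_eq_zero fun j _ =>
      if_neg (by omega)).symm
    refine coeff_eq_zero_of_totalDegree_lt (hp.trans_lt ?_)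
    change 3 < m.degree
    rw [Finsupp.degree_eq_sum, Fin.sum_univ_two]
    omega

theorem totalDegree_bicubic_le {A : Matrix (Fin 4) (Fin 4) ℝ}
    (hA : ∀ i j : Fin 4, 3 < (i : ℕ) + j → A i j = 0) : (bicubic A).totalDegree ≤ 3 := by
  refine totalDegree_finsetSum_le fun i _ => totalDegree_finsetSum_le fun j _ => ?_
  rw [C_mul_X_pow_mul_X_pow_eq_monomial]
  by_cases h : 3 < (i : ℕ) + j
  · simp [hA i j h]
  · refine (totalDegree_monomial_le _ _).trans ?_
    change Finsupp.degree _ ≤ 3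
    simp
    omega

theorem divergence_bicubic (r s : ℝ) (A B : Matrix (Fin 4) (Fin 4) ℝ) :
    r • pderiv (0 : Fin 2) (bicubic A) + s • pderiv (1 : Fin 2) (bicubic B) =
      bicubic (.of fun i j =>
        (if h : (i : ℕ) + 1 < 4 then r * ((i : ℝ) + 1) * A ⟨i + 1, h⟩ j else 0) +
        (if h : (j : ℕ) + 1 < 4 then s * ((j : ℝ) + 1) * B i ⟨j + 1, h⟩ else 0)) := by
  simp [bicubic, Fin.sum_univ_four, smul_eq_C_mul, pderiv_X, Derivation.leibniz,
    Derivation.leibniz_pow, C_add, C_mul,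
    (map_ofNat C 2 : (C 2 : MvPolynomial (Fin 2) ℝ) = 2)]
  ring

/-- Coefficients of the first component of a combination of the basis fields. -/
noncomputable def fstCoeffs (hx : ℝ) (g : Fin 14 → ℝ) : Matrix (Fin 4) (Fin 4) ℝ :=
  !![g 1 - g 5 / 3 - hx * g 7 / 3, g 3 - 3 / 5 * g 9 - hx * g 11 / 3, g 5, g 9;
    hx * (g 4 - g 12 / 3 - g 13 / 3), -(2 * hx * g 8), hx * g 12, 0;
    hx * g 7, hx * g 11, 0, 0;
    hx * g 13 / 3, 0, 0, 0]

/-- Coefficients of the second component of a combination of the basis fields. -/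
noncomputable def sndCoeffs (hy : ℝ) (g : Fin 14 → ℝ) : Matrix (Fin 4) (Fin 4) ℝ :=
  !![g 0 - g 6 / 3 - hy * g 8 / 3, -(hy * (g 4 - g 12 / 3 - g 13 / 3)), hy * g 8, -(hy * g 12 / 3);
    g 2 - 3 / 5 * g 10 + hy * g 11 / 3, -(2 * hy * g 7), -(hy * g 11), 0;
    g 6, -(hy * g 13), 0, 0;
    g 10, 0, 0, 0]

theorem exists_fstCoeffs_eq_and_sndCoeffs_eq {hx hy : ℝ} (hhx : hx ≠ 0) (hhy : hy ≠ 0)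
    {A B : Matrix (Fin 4) (Fin 4) ℝ}
    (hA : ∀ i j : Fin 4, 3 < (i : ℕ) + j → A i j = 0)
    (hB : ∀ i j : Fin 4, 3 < (i : ℕ) + j → B i j = 0)
    (h : ∀ i j : Fin 4,
      (if h : (i : ℕ) + 1 < 4 then 2 / hx * ((i : ℝ) + 1) * A ⟨i + 1, h⟩ j else 0) +
        (if h : (j : ℕ) + 1 < 4 then 2 / hy * ((j : ℝ) + 1) * B i ⟨j + 1, h⟩ else 0) = 0) :
    ∃ g, fstCoeffs hx g = A ∧ sndCoeffs hy g = B := by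
  have h00 := h 0 0
  have h01 := h 0 1
  have h02 := h 0 2
  have h10 := h 1 0
  have h11 := h 1 1
  have h20 := h 2 0
  clear h
  simp [Fin.forall_fin_succ] at hA hB h00 h01 h02 h10 h11 h20
  field_simp at h00 h01 h02 h10 h11 h20
  refine ⟨![B 0 0 + B 2 0 / 3 + B 0 2 / 3,
    A 0 0 + A 0 2 / 3 + A 2 0 / 3,
    B 1 0 + 3 / 5 * B 3 0 - hy / hx * A 2 1 / 3,
    A 0 1 + 3 / 5 * A 0 3 + A 2 1 / 3,
    A 1 0 / hx + A 1 2 / hx / 3 + A 3 0 / hx,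
    A 0 2, B 2 0, A 2 0 / hx, B 0 2 / hy, A 0 3, B 3 0, A 2 1 / hx, A 1 2 / hx,
    3 * A 3 0 / hx], ?_, ?_⟩ <;> ext i j
  · fin_cases i <;> fin_cases j <;> simp [fstCoeffs, *] <;> field_simp <;> try linarith
  · fin_cases i <;> fin_cases j <;> simp [sndCoeffs, *] <;> field_simp <;> try linarith

theorem stmt_10 (hx hy : ℝ) (hhx : 0 < hx) (hhy : 0 < hy)
    (φ : Fin 14 → MvPolynomial (Fin 2) ℝ × MvPolynomial (Fin 2) ℝ)
    (hφ : φ = ![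
      (0, 1),
      (1, 0),
      (0, X 0),
      (X 1, 0),
      (C hx * X 0, -(C hy * X 1)),
      (X 1 ^ 2 - C (1 / 3), 0),
      (0, X 0 ^ 2 - C (1 / 3)),
      (C hx * (X 0 ^ 2 - C (1 / 3)), -(2 * C hy * (X 0 * X 1))),
      (-(2 * C hx * (X 0 * X 1)), C hy * (X 1 ^ 2 - C (1 / 3))),
      (X 1 ^ 3 - C (3 / 5) * X 1, 0),
      (0, X 0 ^ 3 - C (3 / 5) * X 0),
      (C hx * (X 0 ^ 2 - C (1 / 3)) * X 1, -(C hy * X 0 * (X 1 ^ 2 - C (1 / 3)))),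
      (C hx * X 0 * (X 1 ^ 2 - C (1 / 3)), -(C (hy / 3) * (X 1 ^ 3 - X 1))),
      (C (hx / 3) * (X 0 ^ 3 - X 0), -(C hy * (X 0 ^ 2 - C (1 / 3)) * X 1))]) :
    LinearIndependent ℝ φ ∧
      (∀ i, (φ i).1.totalDegree ≤ 3 ∧ (φ i).2.totalDegree ≤ 3 ∧
        (2 / hx) • pderiv (0 : Fin 2) (φ i).1 + (2 / hy) • pderiv (1 : Fin 2) (φ i).2 = 0) ∧
      (Submodule.span ℝ (Set.range φ) : Set (MvPolynomial (Fin 2) ℝ × MvPolynomial (Fin 2) ℝ)) =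
        {w | w.1.totalDegree ≤ 3 ∧ w.2.totalDegree ≤ 3 ∧
          (2 / hx) • pderiv (0 : Fin 2) w.1 + (2 / hy) • pderiv (1 : Fin 2) w.2 = 0} ∧
      Module.finrank ℝ (Submodule.span ℝ (Set.range φ)) = 14 := by
  have hcomb (g : Fin 14 → ℝ) :
      ∑ i, g i • φ i = (bicubic (fstCoeffs hx g), bicubic (sndCoeffs hy g)) := by
    have C_div (a b : ℝ) : (C (a / b) : MvPolynomial (Fin 2) ℝ) = C a * C b⁻¹ := by
      rw [div_eq_mul_inv, C_mul]
    subst hφ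
    have h3 : (C 3 : MvPolynomial (Fin 2) ℝ) = 3 := map_ofNat C 3
    have h2 : (C 2 : MvPolynomial (Fin 2) ℝ) = 2 := map_ofNat C 2
    ext1
    · simp [Fin.sum_univ_succ, bicubic, fstCoeffs, smul_eq_C_mul, C_div, h2, h3]
      ring
    · simp [Fin.sum_univ_succ, bicubic, sndCoeffs, smul_eq_C_mul, C_div, h2, h3]
      ring
  have hmem (g : Fin 14 → ℝ) : (∑ i, g i • φ i).1.totalDegree ≤ 3 ∧
      (∑ i, g i • φ i).2.totalDegree ≤ 3 ∧
      (2 / hx) • pderiv (0 : Fin 2) (∑ i, g i • φ i).1 +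
        (2 / hy) • pderiv (1 : Fin 2) (∑ i, g i • φ i).2 = 0 := by
    rw [hcomb]
    refine ⟨totalDegree_bicubic_le ?_, totalDegree_bicubic_le ?_, ?_⟩
    · intro i j h
      fin_cases i <;> fin_cases j <;> simp [fstCoeffs] at h ⊢
    · intro i j h
      fin_cases i <;> fin_cases j <;> simp [sndCoeffs] at h ⊢
    · rw [divergence_bicubic, bicubic_eq_zero_iff]
      ext i j
      fin_cases i <;> fin_cases j <;> simp [fstCoeffs, sndCoeffs] <;> field_simp <;> ring
  have hli : LinearIndependent ℝ φ := by
    rw [Fintype.linearIndependent_iff]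
    intro g hg
    rw [hcomb, Prod.mk_eq_zero, bicubic_eq_zero_iff, bicubic_eq_zero_iff] at hg
    have hA (i j) : fstCoeffs hx g i j = 0 := by rw [hg.1]; rfl
    have hB (i j) : sndCoeffs hy g i j = 0 := by rw [hg.2]; rfl
    simp [Fin.forall_fin_succ, fstCoeffs, hhx.ne'] at hA
    simp [Fin.forall_fin_succ, sndCoeffs, hhy.ne'] at hB
    clear hmem hcomb hφ hg
    obtain ⟨⟨h1, h3, h5, h9⟩, -⟩ := hA
    obtain ⟨⟨h0, h4, h8, h12⟩, ⟨h2, h7, h11⟩, ⟨h6, h13⟩, h10⟩ := hB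
    simp only [h5, h6, h7, h8, h9, h10, h11, h12, h13, mul_zero, zero_div, sub_zero, add_zero]
      at h0 h1 h2 h3 h4
    intro i
    fin_cases i <;> assumption
  refine ⟨hli, fun i => ?_, ?_, by rw [finrank_span_eq_card hli, Fintype.card_fin]⟩
  · simpa [Pi.single_apply, ite_smul] using hmem (Pi.single i 1)
  · ext w
    rw [SetLike.mem_coe, Submodule.mem_span_range_iff_exists_fun]
    refine ⟨fun ⟨g, hg⟩ => hg ▸ hmem g, fun ⟨h1, h2, hdiv⟩ => ?_⟩
    obtain ⟨A, hA, hwA⟩ := exists_bicubic_eq_of_totalDegree_le h1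
    obtain ⟨B, hB, hwB⟩ := exists_bicubic_eq_of_totalDegree_le h2
    rw [← hwA, ← hwB, divergence_bicubic, bicubic_eq_zero_iff] at hdiv
    obtain ⟨g, rfl, rfl⟩ := exists_fstCoeffs_eq_and_sndCoeffs_eq hhx.ne' hhy.ne' hA hB
      fun i j => congrFun (congrFun hdiv i) j
    exact ⟨g, (hcomb g).trans (Prod.ext hwA hwB)⟩
end

section
/- For every natural number K, the real vector space W^K := {(v₁, v₂) : v₁, v₂ ∈ ℝ[x, y], total degree of v₁ and of v₂ at most K, and ∂v₁/∂x + ∂v₂/∂y = 0} has dimension (K + 1)(K + 4)/2. -/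
open MvPolynomial

/-- A product of submodules is the product of the underlying modules. -/
def Submodule.prodLinearEquiv {R M N : Type*} [Semiring R] [AddCommMonoid M] [AddCommMonoid N]
    [Module R M] [Module R N] (p : Submodule R M) (q : Submodule R N) : p.prod q ≃ₗ[R] p × q where
  toFun x := (⟨x.1.1, x.2.1⟩, ⟨x.1.2, x.2.2⟩)
  map_add' _ _ := rfl
  map_smul' _ _ := rfl
  invFun x := ⟨(x.1, x.2), x.1.2, x.2.2⟩
  left_inv _ := rfl
  right_inv _ := rfl

namespace MvPolynomial

/-- A linear map `T` with `∂ᵢ (T p) = -∂ⱼ p` that does not raise the total degree: on monomials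
it is minus the antiderivative in `Xᵢ` of the derivative in `Xⱼ`. -/
noncomputable def negIntegralPDeriv {σ : Type*} (k : Type*) [Field k] (i j : σ) :
    MvPolynomial σ k →ₗ[k] MvPolynomial σ k :=
  (basisMonomials σ k).constr k fun m ↦
    monomial (m - Finsupp.single j 1 + Finsupp.single i 1)
      (-(m j : k) / ((m - Finsupp.single j 1 : σ →₀ ℕ) i + 1 : ℕ))

variable {σ k : Type*} [Field k]

theorem negIntegralPDeriv_monomial (i j : σ) (m : σ →₀ ℕ) :
    negIntegralPDeriv k i j (monomial m 1) =
      monomial (m - Finsupp.single j 1 + Finsupp.single i 1)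
        (-(m j : k) / ((m - Finsupp.single j 1 : σ →₀ ℕ) i + 1 : ℕ)) :=
  (basisMonomials σ k).constr_basis k _ m

theorem pderiv_negIntegralPDeriv [CharZero k] (i j : σ) (p : MvPolynomial σ k) :
    pderiv i (negIntegralPDeriv k i j p) = -pderiv j p := by
  suffices h : (pderiv i).toLinearMap ∘ₗ negIntegralPDeriv k i j = -(pderiv j).toLinearMap from
    LinearMap.congr_fun h p
  refine (basisMonomials σ k).ext fun m ↦ ?_
  have h : (((m - Finsupp.single j 1 : σ →₀ ℕ) i + 1 : ℕ) : k) ≠ 0 := Nat.cast_ne_zero.mpr (by omega)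
  simp only [coe_basisMonomials, LinearMap.comp_apply, negIntegralPDeriv_monomial,
    Derivation.coeFn_coe, pderiv_monomial, LinearMap.neg_apply, add_tsub_cancel_right,
    Finsupp.add_apply, Finsupp.single_eq_same, div_mul_cancel₀ _ h, one_mul, map_neg]

theorem negIntegralPDeriv_mem_restrictTotalDegree (i j : σ) {K : ℕ} {p : MvPolynomial σ k}
    (hp : p ∈ restrictTotalDegree σ k K) :
    negIntegralPDeriv k i j p ∈ restrictTotalDegree σ k K := by
  suffices h : restrictTotalDegree σ k K ≤
      (restrictTotalDegree σ k K).comap (negIntegralPDeriv k i j) from h hp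
  conv_lhs => rw [restrictTotalDegree, restrictSupport_eq_span]
  rw [Submodule.span_le]
  rintro _ ⟨m, hm, rfl⟩
  simp only [SetLike.mem_coe, Submodule.mem_comap, negIntegralPDeriv_monomial]
  rw [restrictTotalDegree, monomial_mem_restrictSupport]
  by_cases hj : m j = 0
  · simp [hj]
  · left
    obtain ⟨n, rfl⟩ : ∃ n, m = n + Finsupp.single j 1 :=
      ⟨m - Finsupp.single j 1, (Finsupp.sub_add_single_one_cancel hj).symm⟩
    simpa [Finsupp.sum_add_index'] using hm

theorem pderiv_eq_zero_iff_mem_restrictSupport [CharZero k] (i : σ) (p : MvPolynomial σ k) :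
    pderiv i p = 0 ↔ p ∈ restrictSupport k {n | n i = 0} := by
  rw [mem_restrictSupport_iff]
  constructor
  · intro h m hm
    by_contra hi
    have := congrArg (coeff (m - Finsupp.single i 1)) h
    rw [coeff_pderiv, Finsupp.sub_add_single_one_cancel hi, coeff_zero] at this
    exact (mul_ne_zero (mem_support_iff.mp hm) (Nat.cast_add_one_ne_zero _)) this
  · intro h
    ext m
    rw [coeff_pderiv, coeff_zero, mul_eq_zero]
    left
    by_contra hm
    have := h (mem_support_iff.mpr hm)
    simp at this

theorem finrank_restrictSupport (s : Set (σ →₀ ℕ)) :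
    Module.finrank k (restrictSupport k s) = Nat.card s :=
  Module.finrank_eq_nat_card_basis (basisRestrictSupport k s)

variable (k)

theorem finrank_restrictTotalDegree_fin_two (K : ℕ) :
    Module.finrank k (restrictTotalDegree (Fin 2) k K) = (K + 1) * (K + 2) / 2 := by
  let e : {n : Fin 2 →₀ ℕ | (n.sum fun _ e ↦ e) ≤ K} ≃ (i : Fin (K + 1)) × Fin (K + 1 - i) :=
    { toFun n :=
        have h : n.1 0 + n.1 1 ≤ K := by simpa [Finsupp.sum_fintype] using n.2
        ⟨⟨n.1 0, by omega⟩, ⟨n.1 1, by dsimp only; omega⟩⟩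
      invFun x := ⟨(finTwoArrowEquiv' ℕ).symm (x.1, x.2), by
        simp only [Set.mem_ofPred_eq, finTwoArrowEquiv'_sum_eq]
        omega⟩
      left_inv n := by
        ext i
        fin_cases i <;> simp [finTwoArrowEquiv']
      right_inv _ := rfl }
  rw [restrictTotalDegree, finrank_restrictSupport, Nat.card_congr e, Nat.card_sigma]
  simp only [Nat.card_fin]
  rw [Fin.sum_univ_eq_sum_range (fun i ↦ K + 1 - i),
    ← Finset.sum_range_reflect]
  refine (Nat.div_eq_of_eq_mul_left two_pos ?_).symm
  have h := Finset.sum_range_id_mul_two (K + 2)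
  rw [Finset.sum_range_succ', add_zero] at h
  rw [mul_comm (K + 1), ← Nat.add_sub_cancel (n := K + 1) (m := 1), ← h]
  congr 1
  refine Finset.sum_congr rfl fun i hi ↦ ?_
  have := Finset.mem_range.mp hi
  omega

theorem finrank_restrictTotalDegree_fin_two_inf_restrictSupport (K : ℕ) :
    Module.finrank k
      ↥(restrictTotalDegree (Fin 2) k K ⊓ restrictSupport k {n : Fin 2 →₀ ℕ | n 0 = 0}) =
      K + 1 := by
  have hinf : restrictTotalDegree (Fin 2) k K ⊓ restrictSupport k {n : Fin 2 →₀ ℕ | n 0 = 0} =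
      restrictSupport k {n : Fin 2 →₀ ℕ | n 0 = 0 ∧ n 1 ≤ K} := by
    ext p
    rw [restrictTotalDegree, Submodule.mem_inf]
    simp only [mem_restrictSupport_iff, ← Set.subset_inter_iff]
    refine Eq.to_iff (congrArg _ ?_)
    ext n
    simp +contextual [Finsupp.sum_fintype, and_comm]
  let e : {n : Fin 2 →₀ ℕ | n 0 = 0 ∧ n 1 ≤ K} ≃ Fin (K + 1) :=
    { toFun n := ⟨n.1 1, Nat.lt_succ_of_le n.2.2⟩
      invFun j := ⟨(finTwoArrowEquiv' ℕ).symm (0, j), rfl, Nat.le_of_lt_succ j.2⟩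
      left_inv n := by
        have := n.2.1
        ext i
        fin_cases i <;> simp [finTwoArrowEquiv', this]
      right_inv _ := rfl }
  rw [hinf, finrank_restrictSupport, Nat.card_congr e, Nat.card_fin]

end MvPolynomial

theorem stmt_11 (K : ℕ) :
    Module.finrank ℝ
      ↥((MvPolynomial.restrictTotalDegree (Fin 2) ℝ K).comap
            (LinearMap.fst ℝ (MvPolynomial (Fin 2) ℝ) (MvPolynomial (Fin 2) ℝ)) ⊓
          (MvPolynomial.restrictTotalDegree (Fin 2) ℝ K).comap
            (LinearMap.snd ℝ (MvPolynomial (Fin 2) ℝ) (MvPolynomial (Fin 2) ℝ)) ⊓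
          LinearMap.ker
            ((pderiv (0 : Fin 2)).toLinearMap ∘ₗ
                LinearMap.fst ℝ (MvPolynomial (Fin 2) ℝ) (MvPolynomial (Fin 2) ℝ) +
              (pderiv (1 : Fin 2)).toLinearMap ∘ₗ
                LinearMap.snd ℝ (MvPolynomial (Fin 2) ℝ) (MvPolynomial (Fin 2) ℝ))) =
      (K + 1) * (K + 4) / 2 := by
  let P := restrictTotalDegree (Fin 2) ℝ K
  let U := P ⊓ restrictSupport ℝ {n : Fin 2 →₀ ℕ | n 0 = 0}
  let T := negIntegralPDeriv ℝ (0 : Fin 2) 1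
  -- The shear `(v₁, v₂) ↦ (v₂, v₁ - T v₂)` splits off the second entry; what remains of the first
  -- entry has vanishing derivative in `X₀`.
  let e := (LinearEquiv.prodComm ℝ _ _).trans
    ((LinearEquiv.refl ℝ _).skewProd (LinearEquiv.refl ℝ _) (-T))
  have he : ∀ v, e v = (v.2, v.1 - T v.2) := fun v ↦ Prod.ext rfl (sub_eq_add_neg _ _).symm
  have hW : P.comap (LinearMap.fst ℝ _ _) ⊓ P.comap (LinearMap.snd ℝ _ _) ⊓
      LinearMap.ker ((pderiv (0 : Fin 2)).toLinearMap ∘ₗ LinearMap.fst ℝ _ _ +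
        (pderiv (1 : Fin 2)).toLinearMap ∘ₗ LinearMap.snd ℝ _ _) =
      (P.prod U).comap (e : _ →ₗ[ℝ] _) := by
    ext v
    have hT : v.2 ∈ P → T v.2 ∈ P := negIntegralPDeriv_mem_restrictTotalDegree 0 1
    simp only [Submodule.mem_inf, Submodule.mem_comap, LinearMap.mem_ker, LinearMap.add_apply,
      LinearMap.comp_apply, LinearMap.fst_apply, LinearMap.snd_apply, Derivation.coeFn_coe,
      LinearEquiv.coe_coe, he, Submodule.mem_prod, U, T, ← pderiv_eq_zero_iff_mem_restrictSupport,
      map_sub, pderiv_negIntegralPDeriv, sub_neg_eq_add]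
    constructor
    · rintro ⟨⟨h₁, h₂⟩, h⟩
      exact ⟨h₂, sub_mem h₁ (hT h₂), h⟩
    · rintro ⟨h₂, h₁, h⟩
      exact ⟨⟨(Submodule.sub_mem_iff_left P (hT h₂)).mp h₁, h₂⟩, h⟩
  have : Module.Finite ℝ U := Submodule.finiteDimensional_inf_left _ _
  rw [hW, (e.ofSubmodule' _).finrank_eq, (P.prodLinearEquiv U).finrank_eq,
    Module.finrank_prod, finrank_restrictTotalDegree_fin_two,
    finrank_restrictTotalDegree_fin_two_inf_restrictSupport,
    show (K + 1) * (K + 4) = (K + 1) * (K + 2) + (K + 1) * 2 by ring,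
    Nat.add_mul_div_right _ _ two_pos]
end

section
/- Let hx, hy > 0 and let bx₊⁰, bx₊¹, bx₋⁰, bx₋¹, by₊⁰, by₊¹, by₋⁰, by₋¹ be real numbers satisfying the compatibility condition hy·(bx₊⁰ − bx₋⁰) + hx·(by₊⁰ − by₋⁰) = 0. Define a₀ = (bx₊⁰ + bx₋⁰)/2 + (hx/(6hy))(by₊¹ − by₋¹), b₀ = (by₊⁰ + by₋⁰)/2 + (hy/(6hx))(bx₊¹ − bx₋¹), a₁ = (bx₊⁰ − bx₋⁰)/2, b₂ = (by₊⁰ − by₋⁰)/2, a₂ = (bx₊¹ + bx₋¹)/2, b₁ = (by₊¹ + by₋¹)/2, a₃ = −(hx/(4hy))(by₊¹ − by₋¹), b₄ = −(hy/(4hx))(bx₊¹ − bx₋¹), a₄ = (bx₊¹ − bx₋¹)/2, b₃ = (by₊¹ − by₋¹)/2, and set Bx(ξ, η) = a₀ + a₁ξ + a₂η + a₃(ξ² − 1/3) + a₄ξη and By(ξ, η) = b₀ + b₁ξ + b₂η + b₃ξη + b₄(η² − 1/3). Then: (i) Bx(1, η) = bx₊⁰ + bx₊¹η and Bx(−1,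 η) = bx₋⁰ + bx₋¹η for all η; (ii) By(ξ, 1) = by₊⁰ + by₊¹ξ and By(ξ, −1) = by₋⁰ + by₋¹ξ for all ξ; (iii) (2/hx)·∂Bx/∂ξ + (2/hy)·∂By/∂η = 0 identically. -/
/-- The derivative of a quadratic polynomial function. -/
theorem hasDerivAt_quadratic (p q r x : ℝ) :
    HasDerivAt (fun s : ℝ => p + q * s + r * s ^ 2) (q + 2 * r * x) x := by
  have h := (((hasDerivAt_id x).const_mul q).const_add p).add
    ((hasDerivAt_pow 2 x).const_mul r)
  refine h.congr_deriv ?_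
  norm_num
  ring

theorem stmt_13 (hx hy : ℝ) (hhx : 0 < hx) (hhy : 0 < hy)
    (bxp0 bxp1 bxm0 bxm1 byp0 byp1 bym0 bym1 : ℝ)
    (hcompat : hy * (bxp0 - bxm0) + hx * (byp0 - bym0) = 0)
    (a0 a1 a2 a3 a4 b0 b1 b2 b3 b4 : ℝ)
    (ha0 : a0 = (bxp0 + bxm0) / 2 + (hx / (6 * hy)) * (byp1 - bym1))
    (hb0 : b0 = (byp0 + bym0) / 2 + (hy / (6 * hx)) * (bxp1 - bxm1))
    (ha1 : a1 = (bxp0 - bxm0) / 2)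
    (hb2 : b2 = (byp0 - bym0) / 2)
    (ha2 : a2 = (bxp1 + bxm1) / 2)
    (hb1 : b1 = (byp1 + bym1) / 2)
    (ha3 : a3 = -(hx / (4 * hy)) * (byp1 - bym1))
    (hb4 : b4 = -(hy / (4 * hx)) * (bxp1 - bxm1))
    (ha4 : a4 = (bxp1 - bxm1) / 2)
    (hb3 : b3 = (byp1 - bym1) / 2)
    (Bx By : ℝ → ℝ → ℝ)
    (hBx : ∀ ξ η, Bx ξ η = a0 + a1 * ξ + a2 * η + a3 * (ξ ^ 2 - 1 / 3) + a4 * ξ * η)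
    (hBy : ∀ ξ η, By ξ η = b0 + b1 * ξ + b2 * η + b3 * ξ * η + b4 * (η ^ 2 - 1 / 3)) :
    (∀ η, Bx 1 η = bxp0 + bxp1 * η) ∧
      (∀ η, Bx (-1) η = bxm0 + bxm1 * η) ∧
      (∀ ξ, By ξ 1 = byp0 + byp1 * ξ) ∧
      (∀ ξ, By ξ (-1) = bym0 + bym1 * ξ) ∧
      (∀ ξ η, (2 / hx) * deriv (fun s => Bx s η) ξ +
        (2 / hy) * deriv (fun s => By ξ s) η = 0) := by
  have hx0 : hx ≠ 0 := hhx.ne'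
  have hy0 : hy ≠ 0 := hhy.ne'
  have hdx (ξ η : ℝ) : deriv (fun s => Bx s η) ξ = a1 + 2 * a3 * ξ + a4 * η := by
    have hf : (fun s => Bx s η) =
        fun s => (a0 + a2 * η - a3 / 3) + (a1 + a4 * η) * s + a3 * s ^ 2 := by
      ext s
      rw [hBx]
      ring
    rw [hf, (hasDerivAt_quadratic _ _ _ _).deriv]
    ring
  have hdy (ξ η : ℝ) : deriv (fun s => By ξ s) η = b2 + b3 * ξ + 2 * b4 * η := by
    have hf : (fun s => By ξ s) =
        fun s => (b0 + b1 * ξ - b4 / 3) + (b2 + b3 * ξ) * s + b4 * s ^ 2 := by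
      ext s
      rw [hBy]
      ring
    rw [hf, (hasDerivAt_quadratic _ _ _ _).deriv]
  refine ⟨fun η => ?_, fun η => ?_, fun ξ => ?_, fun ξ => ?_, fun ξ η => ?_⟩
  · rw [hBx, ha0, ha1, ha2, ha3, ha4]
    field_simp
    ring
  · rw [hBx, ha0, ha1, ha2, ha3, ha4]
    field_simp
    ring
  · rw [hBy, hb0, hb1, hb2, hb3, hb4]
    field_simp
    ring
  · rw [hBy, hb0, hb1, hb2, hb3, hb4]
    field_simp
    ring
  · rw [hdx, hdy, ha1, ha3, ha4, hb2, hb3, hb4]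
    field_simp
    linear_combination 4 * hcompat
end

section
/- Let hx, hy > 0 and let bx±⁰, bx±¹, bx±², by±⁰, by±¹, by±² be real numbers satisfying hy·(bx₊⁰ − bx₋⁰) + hx·(by₊⁰ − by₋⁰) = 0. Define a₀ = (bx₊⁰ + bx₋⁰)/2 + (hx/(6hy))(by₊¹ − by₋¹), b₀ = (by₊⁰ + by₋⁰)/2 + (hy/(6hx))(bx₊¹ − bx₋¹), a₁ = (bx₊⁰ − bx₋⁰)/2 + (hx/(15hy))(by₊² − by₋²), b₂ = (by₊⁰ − by₋⁰)/2 + (hy/(15hx))(bx₊² − bx₋²), a₂ = (bx₊¹ + bx₋¹)/2, a₄ = (bx₊¹ − bx₋¹)/2, b₁ = (by₊¹ + by₋¹)/2, b₄ = (by₊¹ − by₋¹)/2, a₅ = (bx₊² + bx₋²)/2, a₇ = (bx₊² − bx₋²)/2, b₃ = (by₊² + by₋²)/2, b₆ = (by₊² − by₋²)/2, a₃ = −(hx/(4hy))(by₊¹ − by₋¹), a₆ = −(hx/(6hy))(by₊² − by₋²), b₅ = −(hy/(4hx))(bx₊¹ − bx₋¹), b₇ = −(hy/(6hx))(bx₊²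 − bx₋²), and set Bx(ξ, η) = a₀ + a₁ξ + a₂η + a₃(ξ² − 1/3) + a₄ξη + a₅(η² − 1/3) + a₆(ξ³ − (3/5)ξ) + a₇ξ(η² − 1/3) and By(ξ, η) = b₀ + b₁ξ + b₂η + b₃(ξ² − 1/3) + b₄ξη + b₅(η² − 1/3) + b₆(ξ² − 1/3)η + b₇(η³ − (3/5)η). Then: (i) Bx(±1, η) = bx±⁰ + bx±¹η + bx±²(η² − 1/3) for all η; (ii) By(ξ, ±1) = by±⁰ + by±¹ξ + by±²(ξ² − 1/3) for all ξ; (iii) (2/hx)·∂Bx/∂ξ + (2/hy)·∂By/∂η = 0 identically. -/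
theorem deriv_cubic (c₀ c₁ c₂ c₃ x : ℝ) :
    deriv (fun s : ℝ => c₀ + c₁ * s + c₂ * s ^ 2 + c₃ * s ^ 3) x =
      c₁ + 2 * c₂ * x + 3 * c₃ * x ^ 2 := by
  have h := ((((hasDerivAt_id x).const_mul c₁).const_add c₀).add
    ((hasDerivAt_pow 2 x).const_mul c₂)).add ((hasDerivAt_pow 3 x).const_mul c₃)
  refine (HasDerivAt.deriv h).trans ?_
  push_cast
  ring

theorem stmt_14 (hx hy : ℝ) (hhx : 0 < hx) (hhy : 0 < hy)
    (bxp0 bxp1 bxp2 bxm0 bxm1 bxm2 byp0 byp1 byp2 bym0 bym1 bym2 : ℝ)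
    (hcompat : hy * (bxp0 - bxm0) + hx * (byp0 - bym0) = 0)
    (a0 a1 a2 a3 a4 a5 a6 a7 b0 b1 b2 b3 b4 b5 b6 b7 : ℝ)
    (ha0 : a0 = (bxp0 + bxm0) / 2 + (hx / (6 * hy)) * (byp1 - bym1))
    (hb0 : b0 = (byp0 + bym0) / 2 + (hy / (6 * hx)) * (bxp1 - bxm1))
    (ha1 : a1 = (bxp0 - bxm0) / 2 + (hx / (15 * hy)) * (byp2 - bym2))
    (hb2 : b2 = (byp0 - bym0) / 2 + (hy / (15 * hx)) * (bxp2 - bxm2))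
    (ha2 : a2 = (bxp1 + bxm1) / 2)
    (ha4 : a4 = (bxp1 - bxm1) / 2)
    (hb1 : b1 = (byp1 + bym1) / 2)
    (hb4 : b4 = (byp1 - bym1) / 2)
    (ha5 : a5 = (bxp2 + bxm2) / 2)
    (ha7 : a7 = (bxp2 - bxm2) / 2)
    (hb3 : b3 = (byp2 + bym2) / 2)
    (hb6 : b6 = (byp2 - bym2) / 2)
    (ha3 : a3 = -(hx / (4 * hy)) * (byp1 - bym1))
    (ha6 : a6 = -(hx / (6 * hy)) * (byp2 - bym2))
    (hb5 : b5 = -(hy / (4 * hx)) * (bxp1 - bxm1))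
    (hb7 : b7 = -(hy / (6 * hx)) * (bxp2 - bxm2))
    (Bx By : ℝ → ℝ → ℝ)
    (hBx : ∀ ξ η, Bx ξ η = a0 + a1 * ξ + a2 * η + a3 * (ξ ^ 2 - 1 / 3) + a4 * ξ * η +
      a5 * (η ^ 2 - 1 / 3) + a6 * (ξ ^ 3 - (3 / 5) * ξ) + a7 * ξ * (η ^ 2 - 1 / 3))
    (hBy : ∀ ξ η, By ξ η = b0 + b1 * ξ + b2 * η + b3 * (ξ ^ 2 - 1 / 3) + b4 * ξ * η +
      b5 * (η ^ 2 - 1 / 3) + b6 * (ξ ^ 2 - 1 / 3) * η + b7 * (η ^ 3 - (3 / 5) * η)) :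
    (∀ η, Bx 1 η = bxp0 + bxp1 * η + bxp2 * (η ^ 2 - 1 / 3)) ∧
      (∀ η, Bx (-1) η = bxm0 + bxm1 * η + bxm2 * (η ^ 2 - 1 / 3)) ∧
      (∀ ξ, By ξ 1 = byp0 + byp1 * ξ + byp2 * (ξ ^ 2 - 1 / 3)) ∧
      (∀ ξ, By ξ (-1) = bym0 + bym1 * ξ + bym2 * (ξ ^ 2 - 1 / 3)) ∧
      (∀ ξ η, (2 / hx) * deriv (fun s => Bx s η) ξ +
        (2 / hy) * deriv (fun s => By ξ s) η = 0) := by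
  refine ⟨fun η => ?_, fun η => ?_, fun ξ => ?_, fun ξ => ?_, fun ξ η => ?_⟩
  · rw [hBx, ha0, ha1, ha2, ha3, ha4, ha5, ha6, ha7]
    ring
  · rw [hBx, ha0, ha1, ha2, ha3, ha4, ha5, ha6, ha7]
    ring
  · rw [hBy, hb0, hb1, hb2, hb3, hb4, hb5, hb6, hb7]
    ring
  · rw [hBy, hb0, hb1, hb2, hb3, hb4, hb5, hb6, hb7]
    ring
  · have hBx_cubic : (fun s => Bx s η) = fun s =>
        (a0 + a2 * η - a3 / 3 + a5 * (η ^ 2 - 1 / 3)) +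
          (a1 + a4 * η - 3 / 5 * a6 + a7 * (η ^ 2 - 1 / 3)) * s + a3 * s ^ 2 + a6 * s ^ 3 := by
      funext s
      rw [hBx]
      ring
    have hBy_cubic : (fun s => By ξ s) = fun s =>
        (b0 + b1 * ξ + b3 * (ξ ^ 2 - 1 / 3) - b5 / 3) +
          (b2 + b4 * ξ + b6 * (ξ ^ 2 - 1 / 3) - 3 / 5 * b7) * s + b5 * s ^ 2 + b7 * s ^ 3 := by
      funext s
      rw [hBy]
      ring
    have hflux : (bxp0 - bxm0) / hx + (byp0 - bym0) / hy = 0 := by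
      field_simp
      linarith
    rw [hBx_cubic, hBy_cubic, deriv_cubic, deriv_cubic, ← hflux,
      ha1, ha3, ha4, ha6, ha7, hb2, hb4, hb5, hb6, hb7]
    field_simp
    ring
end

section
/- Let hx, hy > 0 and let bx±⁰, bx±¹, bx±², bx±³, by±⁰, by±¹, by±², by±³ be real numbers satisfying hy·(bx₊⁰ − bx₋⁰) + hx·(by₊⁰ − by₋⁰) = 0. Define a₀ = (bx₊⁰+bx₋⁰)/2 + (hx/(6hy))(by₊¹−by₋¹), b₀ = (by₊⁰+by₋⁰)/2 + (hy/(6hx))(bx₊¹−bx₋¹), a₁ = (bx₊⁰−bx₋⁰)/2 + (hx/(15hy))(by₊²−by₋²), b₂ = (by₊⁰−by₋⁰)/2 + (hy/(15hx))(bx₊²−bx₋²), a₃ = (hx/hy)((3/70)(by₊³−by₋³) − (1/4)(by₊¹−by₋¹)), b₅ = (hy/hx)((3/70)(bx₊³−bx₋³) − (1/4)(bx₊¹−bx₋¹)), a₄ = (bx₊¹−bx₋¹)/2, b₄ = (by₊¹−by₋¹)/2, a₅ = (bx₊²+bx₋²)/2, a₈ = (bx₊²−bx₋²)/2, b₃ =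 (by₊²+by₋²)/2, b₇ = (by₊²−by₋²)/2, a₆ = −(hx/(6hy))(by₊²−by₋²), a₁₀ = −(hx/(8hy))(by₊³−by₋³), b₉ = −(hy/(6hx))(bx₊²−bx₋²), b₁₁ = −(hy/(8hx))(bx₊³−bx₋³), a₉ = (bx₊³+bx₋³)/2, a₁₁ = (bx₊³−bx₋³)/2, b₆ = (by₊³+by₋³)/2, b₁₀ = (by₊³−by₋³)/2, and let a₂, a₇, b₁, b₈ be any real numbers satisfying a₂ + (2/3)a₇ = (bx₊¹+bx₋¹)/2, b₁ + (2/3)b₈ = (by₊¹+by₋¹)/2, and hy·a₇ + hx·b₈ = 0. Set Bx(ξ,η) = a₀ + a₁ξ + a₂η + a₃(ξ²−1/3) + a₄ξη + a₅(η²−1/3) + a₆(ξ³−(3/5)ξ) + a₇(ξ²−1/3)η + a₈ξ(η²−1/3) + a₉(η³−(3/5)η) + a₁₀(ξ⁴−(6/7)ξ²+3/35) + a₁₁ξ(η³−(3/5)η) and By(ξ,η) = b₀ + b₁ξ + b₂η + b₃(ξ²−1/3) + b₄ξη + b₅(η²−1/3) + b₆(ξ³−(3/5)ξ) + b₇(ξ²−1/3)η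 + b₈ξ(η²−1/3) + b₉(η³−(3/5)η) + b₁₀η(ξ³−(3/5)ξ) + b₁₁(η⁴−(6/7)η²+3/35). Then: (i) Bx(±1, η) = bx±⁰ + bx±¹η + bx±²(η²−1/3) + bx±³(η³−(3/5)η) for all η; (ii) By(ξ, ±1) = by±⁰ + by±¹ξ + by±²(ξ²−1/3) + by±³(ξ³−(3/5)ξ) for all ξ; (iii) (2/hx)·∂Bx/∂ξ + (2/hy)·∂By/∂η = 0 identically. -/
theorem hasDerivAt_quartic (c₀ c₁ c₂ c₃ c₄ x : ℝ) :
    HasDerivAt (fun s => c₀ + c₁ * s + c₂ * s ^ 2 + c₃ * s ^ 3 + c₄ * s ^ 4)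
      (c₁ + 2 * c₂ * x + 3 * c₃ * x ^ 2 + 4 * c₄ * x ^ 3) x := by
  have h := ((((hasDerivAt_const x c₀).add ((hasDerivAt_id x).const_mul c₁)).add
    ((hasDerivAt_pow 2 x).const_mul c₂)).add ((hasDerivAt_pow 3 x).const_mul c₃)).add
    ((hasDerivAt_pow 4 x).const_mul c₄)
  refine h.congr_deriv ?_
  norm_num
  ring


theorem stmt_15 (hx hy : ℝ) (hhx : 0 < hx) (hhy : 0 < hy)
    (bxp0 bxp1 bxp2 bxp3 bxm0 bxm1 bxm2 bxm3 byp0 byp1 byp2 byp3 bym0 bym1 bym2 bym3 : ℝ)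
    (hcompat : hy * (bxp0 - bxm0) + hx * (byp0 - bym0) = 0)
    (a0 a1 a2 a3 a4 a5 a6 a7 a8 a9 a10 a11 b0 b1 b2 b3 b4 b5 b6 b7 b8 b9 b10 b11 : ℝ)
    (ha0 : a0 = (bxp0 + bxm0) / 2 + (hx / (6 * hy)) * (byp1 - bym1))
    (hb0 : b0 = (byp0 + bym0) / 2 + (hy / (6 * hx)) * (bxp1 - bxm1))
    (ha1 : a1 = (bxp0 - bxm0) / 2 + (hx / (15 * hy)) * (byp2 - bym2))
    (hb2 : b2 = (byp0 - bym0) / 2 + (hy / (15 * hx)) * (bxp2 - bxm2))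
    (ha3 : a3 = (hx / hy) * ((3 / 70) * (byp3 - bym3) - (1 / 4) * (byp1 - bym1)))
    (hb5 : b5 = (hy / hx) * ((3 / 70) * (bxp3 - bxm3) - (1 / 4) * (bxp1 - bxm1)))
    (ha4 : a4 = (bxp1 - bxm1) / 2)
    (hb4 : b4 = (byp1 - bym1) / 2)
    (ha5 : a5 = (bxp2 + bxm2) / 2)
    (ha8 : a8 = (bxp2 - bxm2) / 2)
    (hb3 : b3 = (byp2 + bym2) / 2)
    (hb7 : b7 = (byp2 - bym2) / 2)
    (ha6 : a6 = -(hx / (6 * hy)) * (byp2 - bym2))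
    (ha10 : a10 = -(hx / (8 * hy)) * (byp3 - bym3))
    (hb9 : b9 = -(hy / (6 * hx)) * (bxp2 - bxm2))
    (hb11 : b11 = -(hy / (8 * hx)) * (bxp3 - bxm3))
    (ha9 : a9 = (bxp3 + bxm3) / 2)
    (ha11 : a11 = (bxp3 - bxm3) / 2)
    (hb6 : b6 = (byp3 + bym3) / 2)
    (hb10 : b10 = (byp3 - bym3) / 2)
    (ha2 : a2 + (2 / 3) * a7 = (bxp1 + bxm1) / 2)
    (hb1 : b1 + (2 / 3) * b8 = (byp1 + bym1) / 2)
    (hab : hy * a7 + hx * b8 = 0)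
    (Bx By : ℝ → ℝ → ℝ)
    (hBx : ∀ ξ η, Bx ξ η = a0 + a1 * ξ + a2 * η + a3 * (ξ ^ 2 - 1 / 3) + a4 * ξ * η +
      a5 * (η ^ 2 - 1 / 3) + a6 * (ξ ^ 3 - (3 / 5) * ξ) + a7 * (ξ ^ 2 - 1 / 3) * η +
      a8 * ξ * (η ^ 2 - 1 / 3) + a9 * (η ^ 3 - (3 / 5) * η) +
      a10 * (ξ ^ 4 - (6 / 7) * ξ ^ 2 + 3 / 35) + a11 * ξ * (η ^ 3 - (3 / 5) * η))
    (hBy : ∀ ξ η, By ξ η = b0 + b1 * ξ + b2 * η + b3 * (ξ ^ 2 - 1 / 3) + b4 * ξ * η +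
      b5 * (η ^ 2 - 1 / 3) + b6 * (ξ ^ 3 - (3 / 5) * ξ) + b7 * (ξ ^ 2 - 1 / 3) * η +
      b8 * ξ * (η ^ 2 - 1 / 3) + b9 * (η ^ 3 - (3 / 5) * η) +
      b10 * η * (ξ ^ 3 - (3 / 5) * ξ) + b11 * (η ^ 4 - (6 / 7) * η ^ 2 + 3 / 35)) :
    (∀ η, Bx 1 η = bxp0 + bxp1 * η + bxp2 * (η ^ 2 - 1 / 3) + bxp3 * (η ^ 3 - (3 / 5) * η)) ∧
      (∀ η, Bx (-1) η = bxm0 + bxm1 * η + bxm2 * (η ^ 2 - 1 / 3) + bxm3 * (η ^ 3 - (3 / 5) * η)) ∧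
      (∀ ξ, By ξ 1 = byp0 + byp1 * ξ + byp2 * (ξ ^ 2 - 1 / 3) + byp3 * (ξ ^ 3 - (3 / 5) * ξ)) ∧
      (∀ ξ, By ξ (-1) = bym0 + bym1 * ξ + bym2 * (ξ ^ 2 - 1 / 3) + bym3 * (ξ ^ 3 - (3 / 5) * ξ)) ∧
      (∀ ξ η, (2 / hx) * deriv (fun s => Bx s η) ξ +
        (2 / hy) * deriv (fun s => By ξ s) η = 0) := by
  have hx0 : hx ≠ 0 := hhx.ne'
  have hy0 : hy ≠ 0 := hhy.ne'
  refine ⟨fun η => ?_, fun η => ?_, fun ξ => ?_, fun ξ => ?_, fun ξ η => ?_⟩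
  · rw [hBx, ha0, ha1, ha3, ha4, ha5, ha6, ha8, ha9, ha10, ha11]
    linear_combination η * ha2
  · rw [hBx, ha0, ha1, ha3, ha4, ha5, ha6, ha8, ha9, ha10, ha11]
    linear_combination η * ha2
  · rw [hBy, hb0, hb2, hb3, hb4, hb5, hb6, hb7, hb9, hb10, hb11]
    linear_combination ξ * hb1
  · rw [hBy, hb0, hb2, hb3, hb4, hb5, hb6, hb7, hb9, hb10, hb11]
    linear_combination ξ * hb1
  · have hdx : HasDerivAt (fun s => Bx s η) (a1 + 2 * a3 * ξ + a4 * η +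
        a6 * (3 * ξ ^ 2 - 3 / 5) + 2 * a7 * ξ * η + a8 * (η ^ 2 - 1 / 3) +
        a10 * (4 * ξ ^ 3 - (12 / 7) * ξ) + a11 * (η ^ 3 - (3 / 5) * η)) ξ := by
      convert hasDerivAt_quartic
        (a0 + a2 * η - a3 / 3 + a5 * (η ^ 2 - 1 / 3) - a7 * η / 3 +
          a9 * (η ^ 3 - (3 / 5) * η) + a10 * (3 / 35))
        (a1 + a4 * η - a6 * (3 / 5) + a8 * (η ^ 2 - 1 / 3) + a11 * (η ^ 3 - (3 / 5) * η))
        (a3 + a7 * η - a10 * (6 / 7)) a6 a10 ξ using 1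
      · funext s
        rw [hBx]
        ring
      · ring
    have hdy : HasDerivAt (fun s => By ξ s) (b2 + b4 * ξ + 2 * b5 * η +
        b7 * (ξ ^ 2 - 1 / 3) + 2 * b8 * ξ * η + b9 * (3 * η ^ 2 - 3 / 5) +
        b10 * (ξ ^ 3 - (3 / 5) * ξ) + b11 * (4 * η ^ 3 - (12 / 7) * η)) η := by
      convert hasDerivAt_quartic
        (b0 + b1 * ξ + b3 * (ξ ^ 2 - 1 / 3) - b5 / 3 + b6 * (ξ ^ 3 - (3 / 5) * ξ) -
          b8 * ξ / 3 + b11 * (3 / 35))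
        (b2 + b4 * ξ + b7 * (ξ ^ 2 - 1 / 3) - b9 * (3 / 5) + b10 * (ξ ^ 3 - (3 / 5) * ξ))
        (b5 + b8 * ξ - b11 * (6 / 7)) b9 b11 η using 1
      · funext s
        rw [hBy]
        ring
      · ring
    rw [hdx.deriv, hdy.deriv, ha1, ha3, ha4, ha6, ha8, ha10, ha11,
      hb2, hb4, hb5, hb7, hb9, hb10, hb11]
    linear_combination (norm := (field_simp; ring))
      hcompat / (hx * hy) + 4 * ξ * η * hab / (hx * hy)
end

section
/- Let Γ = 5/3 and define the constant Lorentz factor γ = (1 − 0.01)^{−1/2}, the constant specific enthalpy h = 1 + Γ·0.1/((Γ − 1)·1), and κ = √(1 + h·γ²). Define, for (x, t) ∈ ℝ², the functions ρ(x,t) = 1, v₁(x,t) = 0, v₂(x,t) = 0.1 sin(2π(x + t/κ)), v₃(x,t) = 0.1 cos(2π(x + t/κ)), B₁(x,t) = 1, B₂(x,t) = κ·v₂(x,t), B₃(x,t) = κ·v₃(x,t), p(x,t) = 0.1. Then these functions satisfy |v| = 0.1 for all (x,t), and the associated conservative variables D = ργ, mᵢ = (ρhγ² + |B|²)vᵢ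 − (v·B)Bᵢ, E = ρhγ² − p − (1/2)(|B|²/γ² + (v·B)²) + |B|², together with the four-magnetic field components bᵢ = γ(Bᵢ/γ² + vᵢ(v·B)) and the total pressure p_tot = p + (1/2)(|B|²/γ² + (v·B)²), satisfy the one-dimensional special RMHD system at every (x, t): ∂D/∂t + ∂(Dv₁)/∂x = 0; ∂m₁/∂t + ∂(m₁v₁ − B₁b₁/γ + p_tot)/∂x = 0; ∂m₂/∂t + ∂(m₂v₁ − B₁b₂/γ)/∂x = 0; ∂m₃/∂t + ∂(m₃v₁ − B₁b₃/γ)/∂x = 0; ∂B₁/∂t = 0; ∂B₂/∂t + ∂(B₂v₁ − B₁v₂)/∂x = 0; ∂B₃/∂t + ∂(B₃v₁ − B₁v₃)/∂x = 0; ∂E/∂t + ∂m₁/∂x = 0. -/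
open Real

theorem deriv_sin_travelling (a c κ x t : ℝ) :
    deriv (fun s => a * Real.sin (c * (x + s / κ))) t =
        a * (Real.cos (c * (x + t / κ)) * (c * (1 / κ))) ∧
      deriv (fun s => a * Real.sin (c * (s + t / κ))) x =
        a * (Real.cos (c * (x + t / κ)) * c) := by
  constructor
  · exact (((((hasDerivAt_id' t).div_const κ).const_add x).const_mul c).sin.const_mul a).deriv
  · simp

theorem deriv_cos_travelling (a c κ x t : ℝ) :
    deriv (fun s => a * Real.cos (c * (x + s / κ))) t =
        a * (-Real.sin (c * (x + t / κ)) * (c * (1 / κ))) ∧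
      deriv (fun s => a * Real.cos (c * (s + t / κ))) x =
        a * (-Real.sin (c * (x + t / κ)) * c) := by
  constructor
  · exact (((((hasDerivAt_id' t).div_const κ).const_add x).const_mul c).cos.const_mul a).deriv
  · simp

theorem stmt_16
    (Γ γ h κ : ℝ)
    (hΓ : Γ = 5 / 3)
    (hγ : γ = (1 - 0.01 : ℝ) ^ (-(1 / 2 : ℝ)))
    (hh : h = 1 + Γ * 0.1 / ((Γ - 1) * 1))
    (hκ : κ = Real.sqrt (1 + h * γ ^ 2))
    (ρ v1 v2 v3 B1 B2 B3 p : ℝ → ℝ → ℝ)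
    (hρ : ∀ x t, ρ x t = 1)
    (hv1 : ∀ x t, v1 x t = 0)
    (hv2 : ∀ x t, v2 x t = 0.1 * Real.sin (2 * Real.pi * (x + t / κ)))
    (hv3 : ∀ x t, v3 x t = 0.1 * Real.cos (2 * Real.pi * (x + t / κ)))
    (hB1 : ∀ x t, B1 x t = 1)
    (hB2 : ∀ x t, B2 x t = κ * v2 x t)
    (hB3 : ∀ x t, B3 x t = κ * v3 x t)
    (hp : ∀ x t, p x t = 0.1)
    (vB Bsq D m1 m2 m3 E b1 b2 b3 ptot : ℝ → ℝ → ℝ)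
    (hvB : ∀ x t, vB x t = v1 x t * B1 x t + v2 x t * B2 x t + v3 x t * B3 x t)
    (hBsq : ∀ x t, Bsq x t = B1 x t ^ 2 + B2 x t ^ 2 + B3 x t ^ 2)
    (hD : ∀ x t, D x t = ρ x t * γ)
    (hm1 : ∀ x t, m1 x t = (ρ x t * h * γ ^ 2 + Bsq x t) * v1 x t - vB x t * B1 x t)
    (hm2 : ∀ x t, m2 x t = (ρ x t * h * γ ^ 2 + Bsq x t) * v2 x t - vB x t * B2 x t)
    (hm3 : ∀ x t, m3 x t = (ρ x t * h * γ ^ 2 + Bsq x t) * v3 x t - vB x t * B3 x t)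
    (hE : ∀ x t, E x t = ρ x t * h * γ ^ 2 - p x t -
      (1 / 2) * (Bsq x t / γ ^ 2 + vB x t ^ 2) + Bsq x t)
    (hb1 : ∀ x t, b1 x t = γ * (B1 x t / γ ^ 2 + v1 x t * vB x t))
    (hb2 : ∀ x t, b2 x t = γ * (B2 x t / γ ^ 2 + v2 x t * vB x t))
    (hb3 : ∀ x t, b3 x t = γ * (B3 x t / γ ^ 2 + v3 x t * vB x t))
    (hptot : ∀ x t, ptot x t = p x t + (1 / 2) * (Bsq x t / γ ^ 2 + vB x t ^ 2)) :
    (∀ x t, Real.sqrt (v1 x t ^ 2 + v2 x t ^ 2 + v3 x t ^ 2) = 0.1) ∧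
      (∀ x t, deriv (fun s => D x s) t + deriv (fun s => D s t * v1 s t) x = 0) ∧
      (∀ x t, deriv (fun s => m1 x s) t +
        deriv (fun s => m1 s t * v1 s t - B1 s t * b1 s t / γ + ptot s t) x = 0) ∧
      (∀ x t, deriv (fun s => m2 x s) t +
        deriv (fun s => m2 s t * v1 s t - B1 s t * b2 s t / γ) x = 0) ∧
      (∀ x t, deriv (fun s => m3 x s) t +
        deriv (fun s => m3 s t * v1 s t - B1 s t * b3 s t / γ) x = 0) ∧
      (∀ x t, deriv (fun s => B1 x s) t = 0) ∧
      (∀ x t, deriv (fun s => B2 x s) t +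
        deriv (fun s => B2 s t * v1 s t - B1 s t * v2 s t) x = 0) ∧
      (∀ x t, deriv (fun s => B3 x s) t +
        deriv (fun s => B3 s t * v1 s t - B1 s t * v3 s t) x = 0) ∧
      (∀ x t, deriv (fun s => E x s) t + deriv (fun s => m1 s t) x = 0) := by
  have hγpos : 0 < γ := by rw [hγ]; positivity
  have hγsq : γ ^ 2 = 100 / 99 := by
    rw [hγ, ← Real.rpow_natCast, ← Real.rpow_mul (by norm_num)]
    norm_num [Real.rpow_neg_one]
  have hh' : h = 5 / 4 := by rw [hh, hΓ]; norm_num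
  have hκpos : 0 < κ := by rw [hκ, hh']; positivity
  have hκsq : κ ^ 2 = 1 + h * γ ^ 2 := by rw [hκ, hh', Real.sq_sqrt (by positivity)]
  have hvsq : ∀ x t, v2 x t ^ 2 + v3 x t ^ 2 = 1 / 100 := fun x t => by
    rw [hv2, hv3]
    linear_combination (1 / 100) * Real.sin_sq_add_cos_sq (2 * Real.pi * (x + t / κ))
  have hvB' : ∀ x t, vB x t = κ / 100 := fun x t => by
    rw [hvB, hv1, hB2, hB3]; linear_combination κ * hvsq x t
  have hBsq' : ∀ x t, Bsq x t = 1 + κ ^ 2 / 100 := fun x t => by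
    rw [hBsq, hB1, hB2, hB3]; linear_combination κ ^ 2 * hvsq x t
  have hm1' : ∀ x t, m1 x t = -(κ / 100) := fun x t => by
    rw [hm1, hv1, hvB', hB1]; ring
  have hm2' : ∀ x t, m2 x t = (κ ^ 2 * 0.1) * Real.sin (2 * Real.pi * (x + t / κ)) :=
    fun x t => by
      rw [hm2, hvB', hB2, hBsq', hρ, hv2]
      linear_combination (-(0.1 * Real.sin (2 * Real.pi * (x + t / κ)))) * hκsq
  have hm3' : ∀ x t, m3 x t = (κ ^ 2 * 0.1) * Real.cos (2 * Real.pi * (x + t / κ)) :=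
    fun x t => by
      rw [hm3, hvB', hB3, hBsq', hρ, hv3]
      linear_combination (-(0.1 * Real.cos (2 * Real.pi * (x + t / κ)))) * hκsq
  have hf2 : ∀ x t, m2 x t * v1 x t - B1 x t * b2 x t / γ =
      (-κ * 0.1) * Real.sin (2 * Real.pi * (x + t / κ)) := fun x t => by
    rw [hv1, hB1, hb2, hvB', hB2, hv2, hγsq]; field_simp; ring
  have hf3 : ∀ x t, m3 x t * v1 x t - B1 x t * b3 x t / γ =
      (-κ * 0.1) * Real.cos (2 * Real.pi * (x + t / κ)) := fun x t => by
    rw [hv1, hB1, hb3, hvB', hB3, hv3, hγsq]; field_simp; ring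
  have hB2' : ∀ x t, B2 x t = (κ * 0.1) * Real.sin (2 * Real.pi * (x + t / κ)) :=
    fun x t => by rw [hB2, hv2]; ring
  have hB3' : ∀ x t, B3 x t = (κ * 0.1) * Real.cos (2 * Real.pi * (x + t / κ)) :=
    fun x t => by rw [hB3, hv3]; ring
  have hg2 : ∀ x t, B2 x t * v1 x t - B1 x t * v2 x t =
      (-0.1) * Real.sin (2 * Real.pi * (x + t / κ)) := fun x t => by
    rw [hv1, hB1, hv2]; ring
  have hg3 : ∀ x t, B3 x t * v1 x t - B1 x t * v3 x t =
      (-0.1) * Real.cos (2 * Real.pi * (x + t / κ)) := fun x t => by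
    rw [hv1, hB1, hv3]; ring
  refine ⟨fun x t => ?_, fun x t => ?_, fun x t => ?_, fun x t => ?_, fun x t => ?_,
    fun x t => ?_, fun x t => ?_, fun x t => ?_, fun x t => ?_⟩
  · rw [hv1, Real.sqrt_eq_iff_mul_self_eq_of_pos (by norm_num)]
    linear_combination -hvsq x t
  · simp only [hD, hρ, hv1, mul_zero, deriv_const, add_zero]
  · simp only [hm1', hv1, hB1, hb1, hptot, hp, hvB', hBsq', deriv_const, add_zero]
  · simp only [hf2]
    simp only [hm2']
    rw [(deriv_sin_travelling _ _ _ _ _).1, (deriv_sin_travelling _ _ _ _ _).2]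
    field_simp; ring
  · simp only [hf3]
    simp only [hm3']
    rw [(deriv_cos_travelling _ _ _ _ _).1, (deriv_cos_travelling _ _ _ _ _).2]
    field_simp; ring
  · simp only [hB1, deriv_const]
  · simp only [hg2]
    simp only [hB2']
    rw [(deriv_sin_travelling _ _ _ _ _).1, (deriv_sin_travelling _ _ _ _ _).2]
    field_simp; ring
  · simp only [hg3]
    simp only [hB3']
    rw [(deriv_cos_travelling _ _ _ _ _).1, (deriv_cos_travelling _ _ _ _ _).2]
    field_simp; ring
  · simp only [hE, hm1', hρ, hp, hvB', hBsq', deriv_const, add_zero]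
end
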